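/- arXiv:1909.05683 — 2 statements merged into one kernel-verified Lean document; each statement's English description precedes it below -/
import Mathlib

section
/- Suppose that either 0 ≤ μ < 1 and λ > 0, or μ = 1 and λ > 2. Then there exists a constant C > 0 (depending only on λ and μ) such that for all t ≥ 0, A(t)^{−1} ∫₀ᵗ A(s)(1+s)^{−2μ} ds ≤ C (1+t)^{−μ}, where A(t) = exp(∫₀ᵗ λ/(2(1+τ)^μ) dτ). -/
noncomputable section
open Real Set

/-- Partial derivative with respect to time of a function of `(t, x)`. -/
def pdt (f : ℝ → ℝ → ℝ) (t x : ℝ) : ℝ := deriv (fun τ => f τ x) t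

/-- Partial derivative with respect to space of a function of `(t, x)`. -/
def pdx (f : ℝ → ℝ → ℝ) (t x : ℝ) : ℝ := deriv (fun ξ => f t ξ) x

/-- The strip `[0,T] × ℝ`. -/
def strip (T : ℝ) : Set (ℝ × ℝ) := Set.Icc 0 T ×ˢ (Set.univ : Set ℝ)

/-- The half-space `[0,∞) × ℝ`. -/
def stripInf : Set (ℝ × ℝ) := Set.Ici (0 : ℝ) ×ˢ (Set.univ : Set ℝ)

/-- The pressure `p(u) = u^(-γ)/γ`. -/
def pres (γ u : ℝ) : ℝ := u ^ (-γ) / γ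

/-- The sound speed `c(u) = u^(-(γ+1)/2)`. -/
def cspeed (γ u : ℝ) : ℝ := u ^ (-(γ + 1) / 2)

/-- The first Riemann invariant `r = v - (2/(γ-1)) u^(-(γ-1)/2) + 2/(γ-1)`. -/
def rInv (γ u v : ℝ) : ℝ := v - (2 / (γ - 1)) * u ^ (-(γ - 1) / 2) + 2 / (γ - 1)

/-- The second Riemann invariant `s = v + (2/(γ-1)) u^(-(γ-1)/2) - 2/(γ-1)`. -/
def sInv (γ u v : ℝ) : ℝ := v + (2 / (γ - 1)) * u ^ (-(γ - 1) / 2) - 2 / (γ - 1)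

/-- `(u,v)` solves the damped compressible Euler system on the set `S`. -/
def IsEulerOn (γ lam μ : ℝ) (u v : ℝ → ℝ → ℝ) (S : Set (ℝ × ℝ)) : Prop :=
  ∀ p ∈ S, pdt u p.1 p.2 - pdx v p.1 p.2 = 0 ∧
    pdt v p.1 p.2 + pdx (fun t x => pres γ (u t x)) p.1 p.2
      = -(lam / (1 + p.1) ^ μ) * v p.1 p.2

/-- `f` is `C¹` on `S ⊆ ℝ × ℝ`. -/
def IsC1On (f : ℝ → ℝ → ℝ) (S : Set (ℝ × ℝ)) : Prop :=
  ContDiffOn ℝ 1 (fun p : ℝ × ℝ => f p.1 p.2) S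

/-- `f` is `C²` on `S ⊆ ℝ × ℝ`. -/
def IsC2On (f : ℝ → ℝ → ℝ) (S : Set (ℝ × ℝ)) : Prop :=
  ContDiffOn ℝ 2 (fun p : ℝ × ℝ => f p.1 p.2) S

/-- `f` is `C¹_b` on `S ⊆ ℝ × ℝ`: `C¹` with `f` and its first partials bounded. -/
def IsC1bOn (f : ℝ → ℝ → ℝ) (S : Set (ℝ × ℝ)) : Prop :=
  IsC1On f S ∧ ∃ M : ℝ, ∀ p ∈ S, |f p.1 p.2| + |pdt f p.1 p.2| + |pdx f p.1 p.2| ≤ M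

/-- `f : ℝ → ℝ` is `C¹_b`. -/
def IsC1b (f : ℝ → ℝ) : Prop :=
  ContDiff ℝ 1 f ∧ ∃ M : ℝ, ∀ x, |f x| + |deriv f x| ≤ M

/-- The damping coefficient `λ/(2(1+t)^μ)`. -/
def damp (lam μ t : ℝ) : ℝ := lam / (2 * (1 + t) ^ μ)

/-- `A(t) = exp(∫₀ᵗ λ/(2(1+τ)^μ) dτ)`. -/
def Afun (lam μ t : ℝ) : ℝ := Real.exp (∫ τ in (0 : ℝ)..t, damp lam μ τ)

/-- `θ_γ(u)`. -/
def theta (γ u : ℝ) : ℝ :=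
  if γ = 3 then Real.log u else (4 / (3 - γ)) * (u ^ ((3 - γ) / 4) - 1)

lemma continuousOn_damp (lam μ : ℝ) : ContinuousOn (damp lam μ) (Ioi (-1)) := by
  intro t ht
  have h : 0 < 1 + t := by linarith [mem_Ioi.1 ht]
  unfold damp
  exact (continuousAt_const.div (continuousAt_const.mul
    ((continuousAt_const.add continuousAt_id).rpow_const (Or.inl h.ne')))
    (mul_pos two_pos (rpow_pos_of_pos h μ)).ne').continuousWithinAt

lemma hasDerivAt_Afun (lam μ : ℝ) {t : ℝ} (ht : 0 ≤ t) :
    HasDerivAt (Afun lam μ) (Afun lam μ t * damp lam μ t) t := by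
  have hmem : Ioi (-1 : ℝ) ∈ nhds t := Ioi_mem_nhds (by linarith)
  refine HasDerivAt.exp (intervalIntegral.integral_hasDerivAt_right ?_ ?_ ?_)
  · refine ((continuousOn_damp lam μ).mono fun x hx => ?_).intervalIntegrable
    rw [uIcc_of_le ht] at hx
    exact mem_Ioi.2 (by linarith [hx.1])
  · exact (continuousOn_damp lam μ).stronglyMeasurableAtFilter isOpen_Ioi t
      (mem_Ioi.2 (by linarith))
  · exact (continuousOn_damp lam μ).continuousAt hmem

lemma Afun_pos (lam μ t : ℝ) : 0 < Afun lam μ t := Real.exp_pos _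

lemma exists_shift_mul_rpow_le {lam μ : ℝ}
    (hcase : (0 ≤ μ ∧ μ < 1 ∧ 0 < lam) ∨ (μ = 1 ∧ 2 < lam)) :
    ∃ a ≥ (1 : ℝ), ∃ δ > 0, μ * a ^ (μ - 1) ≤ lam / 2 - δ := by
  rcases hcase with ⟨-, h1, hl⟩ | ⟨rfl, hl⟩
  · have h := (tendsto_rpow_neg_atTop (sub_pos.2 h1)).const_mul μ
    rw [mul_zero] at h
    obtain ⟨a, ha, ha1⟩ := ((h.eventually_lt_const (show 0 < lam / 4 by linarith)).and
      (Filter.eventually_ge_atTop 1)).exists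
    rw [neg_sub] at ha
    exact ⟨a, ha1, lam / 4, by linarith, by linarith⟩
  · exact ⟨1, le_rfl, lam / 2 - 1, by linarith, by simp⟩

lemma hasDerivAt_Afun_mul_rpow (lam μ : ℝ) {a t : ℝ} (ha : 1 ≤ a) (ht : 0 ≤ t) :
    HasDerivAt (fun t => Afun lam μ t * (a + t) ^ (-μ))
      (Afun lam μ t * damp lam μ t * (a + t) ^ (-μ)
        + Afun lam μ t * (-μ * (a + t) ^ (-μ - 1))) t := by
  have h : HasDerivAt (fun t : ℝ => (a + t) ^ (-μ)) (-μ * (a + t) ^ (-μ - 1)) t := by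
    simpa using ((hasDerivAt_id t).const_add a).rpow_const (p := -μ)
      (Or.inl (by simp only [id]; linarith))
  exact (hasDerivAt_Afun lam μ ht).mul h

lemma mul_rpow_le_damp_mul_sub {lam μ a δ t : ℝ} (hμ : 0 ≤ μ) (hμ1 : μ ≤ 1) (ha : 1 ≤ a)
    (hδ : 0 < δ) (h : μ * a ^ (μ - 1) ≤ lam / 2 - δ) (ht : 0 ≤ t) :
    δ * a ^ (-μ) * (1 + t) ^ (-(2 * μ))
      ≤ damp lam μ t * (a + t) ^ (-μ) - μ * (a + t) ^ (-μ - 1) := by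
  have ht1 : 0 < 1 + t := by linarith
  have hat : 0 < a + t := by linarith
  have hpos : 0 < (1 + t) ^ (-μ) := rpow_pos_of_pos ht1 _
  have hposa : 0 < (a + t) ^ (-μ) := rpow_pos_of_pos hat _
  have hdamp : damp lam μ t = lam / 2 * (1 + t) ^ (-μ) := by
    rw [damp, rpow_neg ht1.le]
    have := rpow_pos_of_pos ht1 μ
    field_simp
  have hsplit : (1 + t) ^ (-(2 * μ)) = (1 + t) ^ (-μ) * (1 + t) ^ (-μ) := by
    rw [← rpow_add ht1]; congr 1; ring
  have hscale : a ^ (-μ) * (1 + t) ^ (-μ) ≤ (a + t) ^ (-μ) := by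
    rw [← mul_rpow (by linarith) ht1.le]
    exact rpow_le_rpow_of_nonpos hat (by nlinarith) (by linarith)
  have hsmall : (a + t) ^ (-1 : ℝ) ≤ a ^ (μ - 1) * (1 + t) ^ (-μ) :=
    calc (a + t) ^ (-1 : ℝ) = (a + t) ^ (μ - 1) * (a + t) ^ (-μ) := by
          rw [← rpow_add hat]; congr 1; ring
      _ ≤ a ^ (μ - 1) * (1 + t) ^ (-μ) :=
          mul_le_mul (rpow_le_rpow_of_nonpos (by linarith) (by linarith) (by linarith))
            (rpow_le_rpow_of_nonpos ht1 (by linarith) (by linarith)) hposa.le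
            (rpow_nonneg (by linarith) _)
  have hpow : (a + t) ^ (-μ - 1) = (a + t) ^ (-μ) * (a + t) ^ (-1 : ℝ) := by
    rw [← rpow_add hat]; congr 1
  rw [hdamp, hsplit, hpow]
  calc δ * a ^ (-μ) * ((1 + t) ^ (-μ) * (1 + t) ^ (-μ))
      = δ * (1 + t) ^ (-μ) * (a ^ (-μ) * (1 + t) ^ (-μ)) := by ring
    _ ≤ δ * (1 + t) ^ (-μ) * (a + t) ^ (-μ) := by gcongr
    _ ≤ (lam / 2 - μ * a ^ (μ - 1)) * (1 + t) ^ (-μ) * (a + t) ^ (-μ) := by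
        gcongr; linarith
    _ = lam / 2 * (1 + t) ^ (-μ) * (a + t) ^ (-μ)
          - μ * ((a + t) ^ (-μ) * (a ^ (μ - 1) * (1 + t) ^ (-μ))) := by ring
    _ ≤ _ := by gcongr

/-- key decay lemma. If `0 ≤ μ < 1, λ > 0` or `μ = 1, λ > 2`,
then `A(t)⁻¹ ∫₀ᵗ A(s)(1+s)^(-2μ) ds ≤ C (1+t)^(-μ)`. -/
theorem Afun_decay
    (lam μ : ℝ)
    (hcase : (0 ≤ μ ∧ μ < 1 ∧ 0 < lam) ∨ (μ = 1 ∧ 2 < lam)) :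
    ∃ C > 0, ∀ t ≥ (0:ℝ),
      (Afun lam μ t)⁻¹ * (∫ s in (0:ℝ)..t, Afun lam μ s * (1 + s) ^ (-(2 * μ)))
        ≤ C * (1 + t) ^ (-μ) := by
  have hμ : 0 ≤ μ := by rcases hcase with h | h <;> linarith [h.1]
  have hμ1 : μ ≤ 1 := by
    rcases hcase with h | h
    · exact h.2.1.le
    · exact h.1.le
  obtain ⟨a, ha, δ, hδ, h⟩ := exists_shift_mul_rpow_le hcase
  have hK : 0 < δ * a ^ (-μ) := mul_pos hδ (rpow_pos_of_pos (by linarith) _)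
  refine ⟨(δ * a ^ (-μ))⁻¹, inv_pos.2 hK, fun t ht => ?_⟩
  have hcont : ContinuousOn (fun s => Afun lam μ s * (1 + s) ^ (-(2 * μ))) (Icc 0 t) :=
    fun s hs => ((hasDerivAt_Afun lam μ hs.1).continuousAt.mul
      ((continuousAt_const.add continuousAt_id).rpow_const
        (Or.inl (show (1 : ℝ) + s ≠ 0 by linarith [hs.1])))).continuousWithinAt
  have hderiv : ∀ s, 0 ≤ s → HasDerivAt
      (fun t => (δ * a ^ (-μ))⁻¹ * (Afun lam μ t * (a + t) ^ (-μ))) _ s := fun s hs =>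
    (hasDerivAt_Afun_mul_rpow lam μ ha hs).const_mul (δ * a ^ (-μ))⁻¹
  have hint := intervalIntegral.integral_le_sub_of_hasDeriv_right_of_le ht
    (fun s hs => (hderiv s hs.1).continuousAt.continuousWithinAt)
    (fun s hs => (hderiv s hs.1.le).hasDerivWithinAt)
    (hcont.integrableOn_Icc)
    (fun s hs => by
      rw [le_inv_mul_iff₀ hK]
      have := mul_le_mul_of_nonneg_left (mul_rpow_le_damp_mul_sub hμ hμ1 ha hδ h hs.1.le)
        (Afun_pos lam μ s).le
      linarith)
  have hzero : 0 ≤ (δ * a ^ (-μ))⁻¹ * (Afun lam μ 0 * (a + 0) ^ (-μ)) :=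
    mul_nonneg (inv_pos.2 hK).le
      (mul_nonneg (Afun_pos lam μ 0).le (rpow_nonneg (by linarith) _))
  rw [inv_mul_le_iff₀ (Afun_pos lam μ t)]
  calc _ ≤ (δ * a ^ (-μ))⁻¹ * (Afun lam μ t * (a + t) ^ (-μ)) := by linarith
    _ ≤ (δ * a ^ (-μ))⁻¹ * (Afun lam μ t * (1 + t) ^ (-μ)) := by
        have := Afun_pos lam μ t
        have := rpow_le_rpow_of_nonpos (show 0 < 1 + t by linarith)
          (show 1 + t ≤ a + t by linarith) (show -μ ≤ 0 by linarith)
        gcongr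
    _ = _ := by ring
end
end

section
/- Let γ > 1, λ = 0, and φ, ψ ∈ C¹_b(ℝ). Suppose the initial Riemann invariants r(0,·) and s(0,·) associated with (u(0,x), v(0,x)) = (1 + εφ(x), εψ(x)) satisfy r_x(0,x) ≥ 0 and s_x(0,x) ≥ 0 for all x ∈ ℝ. Then there exists ε₀ > 0 such that for every 0 < ε ≤ ε₀ the (undamped) compressible Euler system u_t − v_x = 0, v_t + p(u)_x = 0 with these initial data has a global C¹_b solution on [0,∞)×ℝ with u everywhere positive, and there is a constant C > 0 with ‖(r_t, s_t)(t)‖_{L^∞} + ‖(r_x, s_x)(t)‖_{L^∞} ≤ C (1+t)^{−1} for all t ≥ 0. -/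
noncomputable section
open Real Set

open Function Topology Filter
open scoped NNReal BoundedContinuousFunction

theorem continuous_integral_of_continuous_limits {Y : Type*} [TopologicalSpace Y]
    [FirstCountableTopology Y] {g : Y → ℝ → ℝ} {s t : Y → ℝ} (hg : Continuous (uncurry g))
    (hs : Continuous s) (ht : Continuous t) :
    Continuous fun x => ∫ y in s x..t x, g x y := by
  have hi : ∀ x c d, IntervalIntegrable (g x) MeasureTheory.volume c d := fun x c d =>
    (hg.comp (Continuous.prodMk_right x)).intervalIntegrable c d
  have h : (fun x => ∫ y in s x..t x, g x y)
      = fun x => (∫ y in (0 : ℝ)..t x, g x y) - ∫ y in (0 : ℝ)..s x, g x y := by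
    funext x
    exact (intervalIntegral.integral_interval_sub_left (hi _ _ _) (hi _ _ _)).symm
  rw [h]
  exact (intervalIntegral.continuous_parametric_intervalIntegral_of_continuous hg ht).sub
    (intervalIntegral.continuous_parametric_intervalIntegral_of_continuous hg hs)

theorem continuous_integral_fst {H : ℝ → ℝ → ℝ} (hH : Continuous (uncurry H)) :
    Continuous (uncurry fun a b => ∫ y in b..max a b, H a y) :=
  continuous_integral_of_continuous_limits (g := fun p : ℝ × ℝ => H p.1)
    (hH.comp (by fun_prop : Continuous fun q : (ℝ × ℝ) × ℝ => (q.1.1, q.2)))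
    continuous_snd (by fun_prop)

theorem continuous_integral_snd {H : ℝ → ℝ → ℝ} (hH : Continuous (uncurry H)) :
    Continuous (uncurry fun a b => ∫ x in b..max a b, H x b) :=
  continuous_integral_of_continuous_limits (g := fun (p : ℝ × ℝ) x => H x p.2)
    (hH.comp (by fun_prop : Continuous fun q : (ℝ × ℝ) × ℝ => (q.2, q.1.2)))
    continuous_snd (by fun_prop)

theorem integral_triangle_swap {H : ℝ → ℝ → ℝ} (hH : Continuous (uncurry H)) {a b : ℝ}
    (hab : b ≤ a) :
    ∫ x in b..a, ∫ y in b..x, H x y = ∫ y in b..a, ∫ x in y..a, H x y := by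
  set G : ℝ → ℝ → ℝ := fun x y => indicator {p : ℝ × ℝ | p.2 < p.1} (uncurry H) (x, y) with hG
  have h1 : ∀ x ∈ uIcc b a, ∫ y in b..x, H x y = ∫ y in b..a, G x y := by
    intro x hx
    rw [uIcc_of_le hab] at hx
    have : G x = indicator (Iio x) (H x) := by
      funext y; simp [hG, indicator]
    rw [this, intervalIntegral.integral_of_le hab, intervalIntegral.integral_of_le hx.1,
      MeasureTheory.setIntegral_indicator measurableSet_Iio,
      MeasureTheory.integral_Ioc_eq_integral_Ioo]
    congr 2
    ext y
    simp only [mem_Ioo, mem_inter_iff, mem_Ioc, mem_Iio]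
    exact ⟨fun h => ⟨⟨h.1, h.2.le.trans hx.2⟩, h.2⟩, fun h => ⟨h.1.1, h.2⟩⟩
  have h2 : ∀ y ∈ uIcc b a, ∫ x in y..a, H x y = ∫ x in b..a, G x y := by
    intro y hy
    rw [uIcc_of_le hab] at hy
    have : (fun x => G x y) = indicator (Ioi y) (fun x => H x y) := by
      funext x; simp [hG, indicator]
    rw [this, intervalIntegral.integral_of_le hab, intervalIntegral.integral_of_le hy.2,
      MeasureTheory.setIntegral_indicator measurableSet_Ioi]
    congr 2
    ext x
    simp only [mem_inter_iff, mem_Ioc, mem_Ioi]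
    exact ⟨fun h => ⟨⟨hy.1.trans_lt h.1, h.2⟩, h.1⟩, fun h => ⟨h.2, h.1.2⟩⟩
  rw [intervalIntegral.integral_congr h1, intervalIntegral.integral_congr h2]
  apply MeasureTheory.intervalIntegral_intervalIntegral_swap
  have : uncurry G = indicator {p : ℝ × ℝ | p.2 < p.1} (uncurry H) := rfl
  rw [this]
  refine MeasureTheory.IntegrableOn.indicator ?_ (measurableSet_lt measurable_snd measurable_fst)
  refine (hH.continuousOn.integrableOn_compact
    (isCompact_uIcc (a := b) (b := a) |>.prod (isCompact_uIcc (a := b) (b := a)))).mono_set ?_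
  exact prod_mono uIoc_subset_uIcc uIoc_subset_uIcc

/-- A function on the plane, vanishing on `a ≤ b`, whose mixed derivative on `b ≤ a` is `-H`. -/
theorem exists_potential {H : ℝ → ℝ → ℝ} (hH : Continuous (uncurry H)) :
    ∃ f : ℝ → ℝ → ℝ, (∀ a b, HasDerivAt (fun a => f a b) (∫ y in b..max a b, H a y) a) ∧
      (∀ a b, HasDerivAt (fun b => f a b) (-∫ x in b..max a b, H x b) b) ∧
      ∀ a b, a ≤ b → f a b = 0 := by
  have hc1 := continuous_integral_fst hH
  have hc2 := continuous_integral_snd hH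
  have hzero : ∀ a b, a ≤ b → ∫ x in b..a, ∫ y in b..max x b, H x y = 0 := by
    intro a b h
    have : ∀ x ∈ uIcc b a, ∫ y in b..max x b, H x y = 0 := by
      intro x hx
      rw [uIcc_of_ge h] at hx
      rw [max_eq_right hx.2, intervalIntegral.integral_same]
    rw [intervalIntegral.integral_congr this]; simp
  refine ⟨fun a b => ∫ x in b..a, ∫ y in b..max x b, H x y, fun a b => ?_, fun a b => ?_, hzero⟩
  · have : Continuous fun x => ∫ y in b..max x b, H x y := hc1.comp (Continuous.prodMk_left b)
    exact this.integral_hasStrictDerivAt b a |>.hasDerivAt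
  · have h : (fun b => ∫ x in b..a, ∫ y in b..max x b, H x y)
        = fun b => ∫ y in b..a, ∫ x in y..max a y, H x y := by
      funext b
      rcases le_total b a with h | h
      · have h1 : ∀ x ∈ uIcc b a, ∫ y in b..max x b, H x y = ∫ y in b..x, H x y := by
          intro x hx
          rw [uIcc_of_le h] at hx
          rw [max_eq_left hx.1]
        have h2 : ∀ y ∈ uIcc b a, ∫ x in y..max a y, H x y = ∫ x in y..a, H x y := by
          intro x hx
          rw [uIcc_of_le h] at hx
          rw [max_eq_left hx.2]
        rw [intervalIntegral.integral_congr h1, intervalIntegral.integral_congr h2,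
          integral_triangle_swap hH h]
      · have : ∀ y ∈ uIcc b a, ∫ x in y..max a y, H x y = 0 := by
          intro x hx
          rw [uIcc_of_ge h] at hx
          rw [max_eq_right hx.1, intervalIntegral.integral_same]
        rw [hzero a b h, intervalIntegral.integral_congr this]; simp
    rw [h]
    have : Continuous fun y => ∫ x in y..max a y, H x y := hc2.comp (Continuous.prodMk_right a)
    exact intervalIntegral.integral_hasDerivAt_left (this.intervalIntegrable _ _)
      this.stronglyMeasurable.stronglyMeasurableAtFilter this.continuousAt

theorem abs_integral_le_exp_fst {L d a b : ℝ} {g : ℝ → ℝ} (hL : 0 < L) (hd : 0 ≤ d)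
    (hg : ∀ y, |g y| ≤ d * exp (L * (max a y - y))) :
    |∫ y in b..max a b, g y| ≤ d / L * exp (L * (max a b - b)) := by
  rcases le_total a b with h | h
  · rw [max_eq_right h, intervalIntegral.integral_same, abs_zero]
    positivity
  · rw [max_eq_left h]
    have hder : ∀ y ∈ uIcc b a, HasDerivAt (fun y => -(d / L) * exp (L * (a - y)))
        (d * exp (L * (a - y))) y := by
      intro y _
      have := ((((hasDerivAt_id y).const_sub a).const_mul L).exp).const_mul (-(d / L))
      convert! this using 1
      simp; field_simp
    have hc : Continuous fun y => d * exp (L * (a - y)) := by fun_prop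
    have hle := intervalIntegral.norm_integral_le_of_norm_le (μ := MeasureTheory.volume)
      (f := g) (g := fun y => d * exp (L * (a - y))) h
      (Eventually.of_forall fun y hy => by
        have := hg y
        rwa [max_eq_left hy.2] at this) (hc.intervalIntegrable _ _)
    rw [intervalIntegral.integral_eq_sub_of_hasDerivAt hder (hc.intervalIntegrable _ _)] at hle
    refine hle.trans ?_
    have : 0 ≤ d / L := by positivity
    simp only [sub_self, mul_zero, exp_zero]
    linarith

theorem abs_integral_le_exp_snd {L d a b : ℝ} {g : ℝ → ℝ} (hL : 0 < L) (hd : 0 ≤ d)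
    (hg : ∀ x, |g x| ≤ d * exp (L * (max x b - b))) :
    |∫ x in b..max a b, g x| ≤ d / L * exp (L * (max a b - b)) := by
  rcases le_total a b with h | h
  · rw [max_eq_right h, intervalIntegral.integral_same, abs_zero]
    positivity
  · rw [max_eq_left h]
    have hder : ∀ y ∈ uIcc b a, HasDerivAt (fun y => (d / L) * exp (L * (y - b)))
        (d * exp (L * (y - b))) y := by
      intro y _
      have := ((((hasDerivAt_id y).sub_const b).const_mul L).exp).const_mul (d / L)
      convert! this using 1
      simp; field_simp
    have hc : Continuous fun y => d * exp (L * (y - b)) := by fun_prop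
    have hle := intervalIntegral.norm_integral_le_of_norm_le (μ := MeasureTheory.volume)
      (f := g) (g := fun y => d * exp (L * (y - b))) h
      (Eventually.of_forall fun y hy => by
        have := hg y
        rwa [max_eq_left hy.1.le] at this) (hc.intervalIntegrable _ _)
    rw [intervalIntegral.integral_eq_sub_of_hasDerivAt hder (hc.intervalIntegrable _ _)] at hle
    refine hle.trans ?_
    have : 0 ≤ d / L := by positivity
    simp only [sub_self, mul_zero, exp_zero]
    linarith

/-- Nonnegative solutions of a linear Volterra equation with two directions of integration. -/
theorem exists_nonneg_volterra {q f g : ℝ → ℝ → ℝ} {M : ℝ} (hM : 0 < M)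
    (hq : Continuous (uncurry q)) (hf : Continuous (uncurry f)) (hg : Continuous (uncurry g))
    (q0 : ∀ a b, 0 ≤ q a b) (f0 : ∀ a b, 0 ≤ f a b) (g0 : ∀ a b, 0 ≤ g a b)
    (q1 : ∀ a b, q a b ≤ M) (f1 : ∀ a b, f a b ≤ M) (g1 : ∀ a b, g a b ≤ M) :
    ∃ F : ℝ → ℝ → ℝ, Continuous (uncurry F) ∧ (∀ a b, 0 ≤ F a b) ∧
      ∀ a b, F a b = q a b + f a b * (∫ y in b..max a b, F a y)
        + g a b * ∫ x in b..max a b, F x b := by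
  set L : ℝ := 4 * M with hLdef
  have hL : 0 < L := by positivity
  set w : ℝ → ℝ → ℝ := fun a b => exp (L * (max a b - b)) with hw
  have hwc : Continuous (uncurry w) := by
    simp only [hw, uncurry_def]; fun_prop
  have hw1 : ∀ a b, 1 ≤ w a b := fun a b => by
    rw [hw]; apply one_le_exp
    have := le_max_right a b
    exact mul_nonneg hL.le (by linarith)
  have hw0 : ∀ a b, 0 < w a b := fun a b => exp_pos _
  have habs : ∀ G : (ℝ × ℝ) →ᵇ ℝ, Continuous (uncurry fun a b => w a b * |G (a, b)|) := fun G =>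
    hwc.mul G.continuous.abs
  set V : ((ℝ × ℝ) →ᵇ ℝ) → ℝ → ℝ → ℝ := fun G a b =>
    q a b + f a b * (∫ y in b..max a b, w a y * |G (a, y)|)
      + g a b * ∫ x in b..max a b, w x b * |G (x, b)| with hV
  have hVc : ∀ G, Continuous (uncurry (V G)) := fun G =>
    (hq.add (hf.mul (continuous_integral_fst (habs G)))).add
      (hg.mul (continuous_integral_snd (habs G)))
  have hI1 : ∀ G (a b c d : ℝ), IntervalIntegrable (fun y => w a y * |(G : (ℝ × ℝ) →ᵇ ℝ) (a, y)|)
      MeasureTheory.volume c d := fun G a b c d =>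
    ((habs G).comp (Continuous.prodMk_right a)).intervalIntegrable c d
  have hI2 : ∀ G (a b c d : ℝ), IntervalIntegrable (fun x => w x b * |(G : (ℝ × ℝ) →ᵇ ℝ) (x, b)|)
      MeasureTheory.volume c d := fun G a b c d =>
    ((habs G).comp (Continuous.prodMk_left b)).intervalIntegrable c d
  have hdiff : ∀ G G' a b, |V G a b - V G' a b| ≤ dist G G' / 2 * w a b := by
    intro G G' a b
    have hp : ∀ a b, abs (w a b * |G (a, b)| - w a b * |G' (a, b)|) ≤ dist G G' * w a b := by
      intro a b
      rw [← mul_sub, abs_mul, abs_of_pos (hw0 a b), mul_comm]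
      refine mul_le_mul_of_nonneg_right ?_ (hw0 a b).le
      exact (abs_abs_sub_abs_le_abs_sub _ _).trans (G.dist_coe_le_dist (a, b))
    have e : V G a b - V G' a b
        = f a b * (∫ y in b..max a b, (w a y * |G (a, y)| - w a y * |G' (a, y)|))
        + g a b * ∫ x in b..max a b, (w x b * |G (x, b)| - w x b * |G' (x, b)|) := by
      rw [intervalIntegral.integral_sub (hI1 G a b _ _) (hI1 G' a b _ _),
        intervalIntegral.integral_sub (hI2 G a b _ _) (hI2 G' a b _ _)]
      simp only [hV]; ring
    rw [e]
    have b1 := abs_integral_le_exp_fst (a := a) (b := b) hL dist_nonneg (fun y => hp a y)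
    have b2 := abs_integral_le_exp_snd (a := a) (b := b) hL dist_nonneg (fun x => hp x b)
    refine (abs_add_le _ _).trans ?_
    rw [abs_mul, abs_mul, abs_of_nonneg (f0 a b), abs_of_nonneg (g0 a b)]
    have c1 := mul_le_mul (f1 a b) b1 (abs_nonneg _) hM.le
    have c2 := mul_le_mul (g1 a b) b2 (abs_nonneg _) hM.le
    refine (add_le_add c1 c2).trans (le_of_eq ?_)
    simp only [hw, hLdef]; field_simp; ring
  have hV0 : ∀ a b, V 0 a b = q a b := by intro a b; simp [hV]
  have hVb : ∀ G a b, |V G a b| ≤ (M + dist G 0 / 2) * w a b := by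
    intro G a b
    have h1 := hdiff G 0 a b
    rw [hV0] at h1
    have h2 : |q a b| ≤ M * w a b := by
      rw [abs_of_nonneg (q0 a b)]
      nlinarith [q1 a b, hw1 a b]
    have := abs_sub_abs_le_abs_sub (V G a b) (q a b)
    linarith
  let 𝒯 : ((ℝ × ℝ) →ᵇ ℝ) → ((ℝ × ℝ) →ᵇ ℝ) := fun G =>
    BoundedContinuousFunction.ofNormedAddCommGroup (fun p => V G p.1 p.2 / w p.1 p.2)
      ((hVc G).div hwc fun p => (hw0 p.1 p.2).ne') (M + dist G 0 / 2) (fun p => by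
        rw [norm_div, Real.norm_eq_abs, Real.norm_eq_abs, abs_of_pos (hw0 p.1 p.2),
          div_le_iff₀ (hw0 p.1 p.2)]
        exact hVb G p.1 p.2)
  have h𝒯 : ∀ G a b, 𝒯 G (a, b) = V G a b / w a b := fun _ _ _ => rfl
  have hcontr : ContractingWith (1 / 2 : ℝ≥0) 𝒯 := by
    refine ⟨by rw [← NNReal.coe_lt_coe]; norm_num, LipschitzWith.of_dist_le_mul fun G G' => ?_⟩
    rw [BoundedContinuousFunction.dist_le (by positivity)]
    rintro ⟨a, b⟩
    rw [h𝒯, h𝒯, Real.dist_eq, ← sub_div, abs_div, abs_of_pos (hw0 a b), div_le_iff₀ (hw0 a b)]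
    refine (hdiff G G' a b).trans (le_of_eq ?_)
    push_cast; ring
  set G := ContractingWith.fixedPoint 𝒯 hcontr with hGdef
  have hfix : 𝒯 G = G := hcontr.fixedPoint_isFixedPt
  have hfix' : ∀ a b, w a b * G (a, b) = V G a b := by
    intro a b
    conv_lhs => rw [← hfix]
    rw [h𝒯, mul_div_cancel₀ _ (hw0 a b).ne']
  have hV_nonneg : ∀ a b, 0 ≤ V G a b := by
    intro a b
    have i1 : 0 ≤ ∫ y in b..max a b, w a y * |G (a, y)| :=
      intervalIntegral.integral_nonneg (le_max_right _ _) fun y _ =>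
        mul_nonneg (hw0 _ _).le (abs_nonneg _)
    have i2 : 0 ≤ ∫ x in b..max a b, w x b * |G (x, b)| :=
      intervalIntegral.integral_nonneg (le_max_right _ _) fun y _ =>
        mul_nonneg (hw0 _ _).le (abs_nonneg _)
    have := mul_nonneg (f0 a b) i1
    have := mul_nonneg (g0 a b) i2
    have := q0 a b
    simp only [hV]; linarith
  have hGabs : ∀ a b, w a b * |G (a, b)| = V G a b := by
    intro a b
    rw [← hfix', abs_of_nonneg]
    have := hV_nonneg a b
    rw [← hfix'] at this
    exact (mul_nonneg_iff_of_pos_left (hw0 a b)).1 this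
  refine ⟨V G, hVc G, hV_nonneg, fun a b => ?_⟩
  simp only [← hGabs]
  rw [hGabs]
/-- The invertible linear map with matrix `!![p, -q; r, s]`, for `0 < p s + q r`. -/
def planeEquiv (p q r s : ℝ) (h : 0 < p * s + q * r) : (ℝ × ℝ) ≃L[ℝ] (ℝ × ℝ) :=
  ContinuousLinearEquiv.equivOfInverse
    ((p • ContinuousLinearMap.fst ℝ ℝ ℝ - q • ContinuousLinearMap.snd ℝ ℝ ℝ).prod
      (r • ContinuousLinearMap.fst ℝ ℝ ℝ + s • ContinuousLinearMap.snd ℝ ℝ ℝ))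
    (((s / (p * s + q * r)) • ContinuousLinearMap.fst ℝ ℝ ℝ
        + (q / (p * s + q * r)) • ContinuousLinearMap.snd ℝ ℝ ℝ).prod
      ((-(r / (p * s + q * r))) • ContinuousLinearMap.fst ℝ ℝ ℝ
        + (p / (p * s + q * r)) • ContinuousLinearMap.snd ℝ ℝ ℝ))
    (fun x => by
      have := mul_inv_cancel₀ h.ne'
      ext
      · simp; linear_combination x.1 * this
      · simp; linear_combination x.2 * this)
    (fun x => by
      have := mul_inv_cancel₀ h.ne'
      ext
      · simp; linear_combination x.1 * this
      · simp; linear_combination x.2 * this)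

theorem mul_sub_le_of_hasDerivAt {f f' : ℝ → ℝ} {m : ℝ} (hf : ∀ x, HasDerivAt f (f' x) x)
    (hm : ∀ x, m ≤ f' x) {x y : ℝ} (hxy : x ≤ y) : m * (y - x) ≤ f y - f x :=
  mul_sub_le_image_sub_of_le_deriv (fun z => (hf z).differentiableAt)
    (fun z => (hf z).deriv.symm ▸ hm z) hxy

theorem hasStrictFDerivAt_of_partials {f f₁ f₂ : ℝ → ℝ → ℝ}
    (h₁ : ∀ a b, HasDerivAt (fun a => f a b) (f₁ a b) a)
    (h₂ : ∀ a b, HasDerivAt (fun b => f a b) (f₂ a b) b)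
    (c₁ : Continuous (uncurry f₁)) (c₂ : Continuous (uncurry f₂)) (p : ℝ × ℝ) :
    HasStrictFDerivAt (uncurry f) (f₁ p.1 p.2 • ContinuousLinearMap.fst ℝ ℝ ℝ
      + f₂ p.1 p.2 • ContinuousLinearMap.snd ℝ ℝ ℝ) p := by
  have := hasStrictFDerivAt_uncurry_coprod (𝕜 := ℝ) (u := p) (f := f)
    (f₁ := fun a b => ContinuousLinearMap.toSpanSingleton ℝ (f₁ a b))
    (f₂ := fun a b => ContinuousLinearMap.toSpanSingleton ℝ (f₂ a b))
    (Eventually.of_forall fun v => (h₁ v.1 v.2).hasFDerivAt)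
    (Eventually.of_forall fun v => (h₂ v.1 v.2).hasFDerivAt)
    (by
      apply Continuous.continuousAt
      exact (ContinuousLinearMap.toSpanSingletonCLE (𝕜 := ℝ) (E := ℝ)).continuous.comp c₁)
    (by
      apply Continuous.continuousAt
      exact (ContinuousLinearMap.toSpanSingletonCLE (𝕜 := ℝ) (E := ℝ)).continuous.comp c₂)
  convert! this using 1
  ext <;> simp [HasUncurry.uncurry]

theorem exists_contDiff_inverse {T X P Q R S : ℝ → ℝ → ℝ} {m : ℝ} (hm : 0 < m)
    (hTa : ∀ a b, HasDerivAt (fun a => T a b) (P a b) a)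
    (hTb : ∀ a b, HasDerivAt (fun b => T a b) (-Q a b) b)
    (hXa : ∀ a b, HasDerivAt (fun a => X a b) (R a b) a)
    (hXb : ∀ a b, HasDerivAt (fun b => X a b) (S a b) b)
    (hP : Continuous (uncurry P)) (hQ : Continuous (uncurry Q))
    (hR : Continuous (uncurry R)) (hS : Continuous (uncurry S))
    (mP : ∀ a b, m ≤ P a b) (mQ : ∀ a b, m ≤ Q a b)
    (mR : ∀ a b, m ≤ R a b) (mS : ∀ a b, m ≤ S a b) :
    ∃ A B : ℝ → ℝ → ℝ, ContDiff ℝ 1 (uncurry A) ∧ ContDiff ℝ 1 (uncurry B) ∧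
      (∀ a b, A (T a b) (X a b) = a ∧ B (T a b) (X a b) = b) ∧
      ∀ t x, ∃ a b, A t x = a ∧ B t x = b ∧ T a b = t ∧ X a b = x ∧
        HasDerivAt (fun t => A t x) (S a b / (P a b * S a b + Q a b * R a b)) t ∧
        HasDerivAt (fun x => A t x) (Q a b / (P a b * S a b + Q a b * R a b)) x ∧
        HasDerivAt (fun t => B t x) (-(R a b / (P a b * S a b + Q a b * R a b))) t ∧
        HasDerivAt (fun x => B t x) (P a b / (P a b * S a b + Q a b * R a b)) x := by
  have hD : ∀ a b, 0 < P a b * S a b + Q a b * R a b := fun a b => by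
    have := hm.trans_le (mP a b)
    have := hm.trans_le (mQ a b)
    have := hm.trans_le (mR a b)
    have := hm.trans_le (mS a b)
    positivity
  set Φ : ℝ × ℝ → ℝ × ℝ := fun p => (T p.1 p.2, X p.1 p.2) with hΦ
  set D : ℝ × ℝ → (ℝ × ℝ) ≃L[ℝ] (ℝ × ℝ) := fun p =>
    planeEquiv (P p.1 p.2) (Q p.1 p.2) (R p.1 p.2) (S p.1 p.2) (hD _ _) with hDdef
  have hstrict : ∀ p, HasStrictFDerivAt Φ (D p : ℝ × ℝ →L[ℝ] ℝ × ℝ) p := by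
    intro p
    have h1 := hasStrictFDerivAt_of_partials hTa hTb hP (f₂ := fun a b => -Q a b) hQ.neg p
    have h2 := hasStrictFDerivAt_of_partials hXa hXb hR hS p
    convert! h1.prodMk h2 using 1
    ext <;> simp [hDdef, planeEquiv]
  have hcontD : ContDiff ℝ 1 Φ := by
    rw [contDiff_one_iff_hasFDerivAt]
    refine ⟨fun p => (D p : ℝ × ℝ →L[ℝ] ℝ × ℝ), ?_, fun p => (hstrict p).hasFDerivAt⟩
    have : (fun p => (D p : ℝ × ℝ →L[ℝ] ℝ × ℝ)) = fun p : ℝ × ℝ =>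
      ((uncurry P p • ContinuousLinearMap.fst ℝ ℝ ℝ
        - uncurry Q p • ContinuousLinearMap.snd ℝ ℝ ℝ).prod
        (uncurry R p • ContinuousLinearMap.fst ℝ ℝ ℝ
        + uncurry S p • ContinuousLinearMap.snd ℝ ℝ ℝ)) := by
      ext p <;> simp [hDdef, planeEquiv, uncurry]
    rw [this]
    have hh : ∀ f g : ℝ × ℝ → ((ℝ × ℝ) →L[ℝ] ℝ), Continuous f → Continuous g →
        Continuous fun p => (f p).prod (g p) := fun f g hf hg =>
      (ContinuousLinearMap.prodₗᵢ (𝕜 := ℝ) (E := ℝ × ℝ) (F := ℝ) (G := ℝ) ℝ).continuous.comp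
        (hf.prodMk hg)
    apply hh <;> fun_prop
  have hanti : AntilipschitzWith (Real.toNNReal (1 / m)) Φ := by
    have key : ∀ a b a' b', a ≤ a' →
        m * max |a - a'| |b - b'| ≤ max |T a b - T a' b'| |X a b - X a' b'| := by
      intro a b a' b' h
      rcases le_total b b' with hb | hb
      · have h1 := mul_sub_le_of_hasDerivAt (fun z => hXa z b) (fun z => mR z b) h
        have h2 := mul_sub_le_of_hasDerivAt (fun z => hXb a' z) (fun z => mS a' z) hb
        refine le_trans ?_ (le_max_right _ _)
        rw [abs_sub_comm a, abs_sub_comm b, abs_sub_comm (X a b),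
          abs_of_nonneg (sub_nonneg.2 h), abs_of_nonneg (sub_nonneg.2 hb)]
        have : m * (a' - a) + m * (b' - b) ≤ |X a' b' - X a b| :=
          le_trans (by linarith) (le_abs_self _)
        have h3 := mul_nonneg hm.le (sub_nonneg.2 h)
        have h4 := mul_nonneg hm.le (sub_nonneg.2 hb)
        rcases max_cases (a' - a) (b' - b) with ⟨e, -⟩ | ⟨e, -⟩ <;> rw [e] <;> linarith
      · have h1 := mul_sub_le_of_hasDerivAt (fun z => hTa z b) (fun z => mP z b) h
        have h2 := mul_sub_le_of_hasDerivAt (fun z => (hTb a' z).neg) (m := m)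
          (fun z => by simpa using mQ a' z) hb
        simp only [Pi.neg_apply] at h2
        refine le_trans ?_ (le_max_left _ _)
        rw [abs_sub_comm a, abs_sub_comm (T a b),
          abs_of_nonneg (sub_nonneg.2 h), abs_of_nonneg (sub_nonneg.2 hb)]
        have : m * (a' - a) + m * (b - b') ≤ |T a' b' - T a b| :=
          le_trans (by linarith) (le_abs_self _)
        have h3 := mul_nonneg hm.le (sub_nonneg.2 h)
        have h4 := mul_nonneg hm.le (sub_nonneg.2 hb)
        rcases max_cases (a' - a) (b - b') with ⟨e, -⟩ | ⟨e, -⟩ <;> rw [e] <;> linarith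
    refine AntilipschitzWith.of_le_mul_dist fun p q => ?_
    rw [Real.coe_toNNReal _ (by positivity), Prod.dist_eq, Prod.dist_eq]
    simp only [Real.dist_eq, hΦ]
    rw [one_div, inv_mul_eq_div, le_div_iff₀ hm, mul_comm]
    rcases le_total p.1 q.1 with h | h
    · exact key _ _ _ _ h
    · have := key q.1 q.2 p.1 p.2 h
      rwa [abs_sub_comm q.1, abs_sub_comm q.2, abs_sub_comm (T q.1 _),
        abs_sub_comm (X q.1 _)] at this
  have hcont : Continuous Φ := hcontD.continuous
  have hopen : IsOpenMap Φ := isOpenMap_of_hasStrictFDerivAt_equiv hstrict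
  have hproper : IsProperMap Φ := isProperMap_iff_tendsto_cocompact.2 ⟨hcont, by
    rw [← Metric.cobounded_eq_cocompact]
    exact hanti.tendsto_cobounded⟩
  have hsurj : Surjective Φ := by
    rw [← range_eq_univ]
    exact IsClopen.eq_univ ⟨hproper.isClosedMap.isClosed_range, hopen.isOpen_range⟩
      (range_nonempty Φ)
  let e : (ℝ × ℝ) ≃ₜ (ℝ × ℝ) :=
    (Equiv.ofBijective Φ ⟨hanti.injective, hsurj⟩).toHomeomorphOfContinuousOpen hcont hopen
  have hsymm : ContDiff ℝ 1 e.symm :=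
    e.contDiff_symm (f₀' := D) (fun p => (hstrict p).hasFDerivAt) hcontD
  refine ⟨fun t x => (e.symm (t, x)).1, fun t x => (e.symm (t, x)).2, hsymm.fst, hsymm.snd,
    fun a b => ?_, fun t x => ?_⟩
  · have : e.symm (T a b, X a b) = (a, b) := by rw [e.symm_apply_eq]; rfl
    exact ⟨congrArg Prod.fst this, congrArg Prod.snd this⟩
  · have h1 : Φ (e.symm (t, x)) = (t, x) := e.apply_symm_apply (t, x)
    have h2 : HasFDerivAt e.symm ((D (e.symm (t, x))).symm : ℝ × ℝ →L[ℝ] ℝ × ℝ) (t, x) :=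
      HasFDerivAt.of_local_left_inverse (f := Φ) e.symm.continuous.continuousAt
        (hstrict _).hasFDerivAt (Eventually.of_forall fun y => e.apply_symm_apply y)
    have ht := h2.comp_hasDerivAt t ((hasDerivAt_id t).prodMk (hasDerivAt_const t x))
    have hx := h2.comp_hasDerivAt x ((hasDerivAt_const x t).prodMk (hasDerivAt_id x))
    refine ⟨_, _, rfl, rfl, congrArg Prod.fst h1, congrArg Prod.snd h1, ?_, ?_, ?_, ?_⟩
    · convert! (hasFDerivAt_fst.comp_hasDerivAt t ht) using 1
      simp [hDdef, planeEquiv]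
    · convert! (hasFDerivAt_fst.comp_hasDerivAt x hx) using 1
      simp [hDdef, planeEquiv]
    · convert! (hasFDerivAt_snd.comp_hasDerivAt t ht) using 1
      simp [hDdef, planeEquiv]
    · convert! (hasFDerivAt_snd.comp_hasDerivAt x hx) using 1
      simp [hDdef, planeEquiv]

/-- Construction of global characteristic coordinates `A`, `B` for the diagonal system with speeds
`-c(A, B)` and `c(A, B)`, in the rarefactive case. -/
theorem exists_characteristic_coordinates {c κ : ℝ → ℝ → ℝ} {ρ σ : ℝ → ℝ} {k₀ k₁ κ₀ κ₁ M : ℝ}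
    (hk₀ : 0 < k₀) (hκ₀ : 0 < κ₀)
    (hc₀ : ∀ a b, k₀ ≤ c a b) (hc₁ : ∀ a b, c a b ≤ k₁)
    (h₀ : ∀ a b, κ₀ ≤ κ a b) (h₁ : ∀ a b, κ a b ≤ κ₁)
    (ρ₀ : ∀ a, 0 ≤ ρ a) (ρ₁ : ∀ a, ρ a ≤ M) (σ₀ : ∀ b, 0 ≤ σ b) (σ₁ : ∀ b, σ b ≤ M)
    (cc : Continuous (uncurry c)) (cκ : Continuous (uncurry κ))
    (cρ : Continuous ρ) (cσ : Continuous σ)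
    (hca : ∀ a b, HasDerivAt (fun a => c a b) (-(2 * c a b * κ a b * ρ a)) a)
    (hcb : ∀ a b, HasDerivAt (fun b => c a b) (2 * c a b * κ a b * σ b) b) :
    ∃ A B : ℝ → ℝ → ℝ, ContDiff ℝ 1 (uncurry A) ∧ ContDiff ℝ 1 (uncurry B) ∧
      (∀ x, A 0 x = x ∧ B 0 x = x) ∧ ∃ C : ℝ, 0 < C ∧ ∀ t, 0 ≤ t → ∀ x, ∃ p q : ℝ,
        HasDerivAt (fun t => A t x) (c (A t x) (B t x) * p) t ∧
        HasDerivAt (fun x => A t x) p x ∧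
        HasDerivAt (fun t => B t x) (-(c (A t x) (B t x) * q)) t ∧
        HasDerivAt (fun x => B t x) q x ∧ 0 ≤ p ∧ 0 ≤ q ∧
        ρ (A t x) * p ≤ C * (1 + t)⁻¹ ∧ σ (B t x) * q ≤ C * (1 + t)⁻¹ := by
  have hcpos : ∀ a b, 0 < c a b := fun a b => hk₀.trans_le (hc₀ a b)
  have hκpos : ∀ a b, 0 < κ a b := fun a b => hκ₀.trans_le (h₀ a b)
  have hk₁ : 0 < k₁ := (hcpos 0 0).trans_le (hc₁ 0 0)
  have hκ₁ : 0 < κ₁ := (hκpos 0 0).trans_le (h₁ 0 0)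
  have hM : 0 ≤ M := (ρ₀ 0).trans (ρ₁ 0)
  set w : ℝ → ℝ := fun a => 1 / (2 * c a a) with hw
  have cdiag : Continuous fun a => c a a := cc.comp (by fun_prop : Continuous fun a : ℝ => (a, a))
  have cw : Continuous w :=
    continuous_const.div (continuous_const.mul cdiag) fun a => by have := hcpos a a; positivity
  have hwpos : ∀ a, 0 < w a := fun a => by have := hcpos a a; simp only [hw]; positivity
  have hw1 : ∀ a, w a ≤ 1 / (2 * k₀) := fun a => by
    simp only [hw]; gcongr; exact hc₀ a a
  have hw0 : ∀ a, 1 / (2 * k₁) ≤ w a := fun a => by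
    have := hcpos a a
    simp only [hw]; gcongr; exact hc₁ a a
  have hcw : ∀ a, c a a * w a = 1 / 2 := fun a => by
    have := hcpos a a
    simp only [hw]; field_simp
  set f : ℝ → ℝ → ℝ := fun a b => κ a b * σ b with hf
  set g : ℝ → ℝ → ℝ := fun a b => κ a b * ρ a with hg
  have cf : Continuous (uncurry f) := cκ.mul (cσ.comp continuous_snd)
  have cg : Continuous (uncurry g) := cκ.mul (cρ.comp continuous_fst)
  have f0 : ∀ a b, 0 ≤ f a b := fun a b => mul_nonneg (hκpos a b).le (σ₀ b)
  have g0 : ∀ a b, 0 ≤ g a b := fun a b => mul_nonneg (hκpos a b).le (ρ₀ a)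
  have f1 : ∀ a b, f a b ≤ κ₁ * M := fun a b => mul_le_mul (h₁ a b) (σ₁ b) (σ₀ b) hκ₁.le
  have g1 : ∀ a b, g a b ≤ κ₁ * M := fun a b => mul_le_mul (h₁ a b) (ρ₁ a) (ρ₀ a) hκ₁.le
  have hκM : 0 ≤ κ₁ * M := mul_nonneg hκ₁.le hM
  have hd : 0 < 1 / (2 * k₀) := by positivity
  obtain ⟨F, cF, F0, hF⟩ := exists_nonneg_volterra
    (q := fun a b => f a b * w a + g a b * w b) (f := f) (g := g)
    (M := κ₁ * M + 2 * (κ₁ * M * (1 / (2 * k₀))) + 1) (by positivity)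
    ((cf.mul (cw.comp continuous_fst)).add (cg.mul (cw.comp continuous_snd))) cf cg
    (fun a b => add_nonneg (mul_nonneg (f0 a b) (hwpos a).le) (mul_nonneg (g0 a b) (hwpos b).le))
    f0 g0
    (fun a b => by
      have e1 := mul_le_mul (f1 a b) (hw1 a) (hwpos a).le hκM
      have e2 := mul_le_mul (g1 a b) (hw1 b) (hwpos b).le hκM
      linarith)
    (fun a b => by have := mul_nonneg hκM hd.le; linarith [f1 a b])
    (fun a b => by have := mul_nonneg hκM hd.le; linarith [g1 a b])
  have cF1 := continuous_integral_fst cF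
  have cF2 := continuous_integral_snd cF
  set P : ℝ → ℝ → ℝ := fun a b => w a + ∫ y in b..max a b, F a y with hP
  set Q : ℝ → ℝ → ℝ := fun a b => w b + ∫ x in b..max a b, F x b with hQ
  have cP : Continuous (uncurry P) := (cw.comp continuous_fst).add cF1
  have cQ : Continuous (uncurry Q) := (cw.comp continuous_snd).add cF2
  have hFPQ : ∀ a b, F a b = f a b * P a b + g a b * Q a b := fun a b => by
    rw [hF]; simp only [hP, hQ]; ring
  have hPw : ∀ a b, w a ≤ P a b := fun a b =>
    le_add_of_nonneg_right (intervalIntegral.integral_nonneg (le_max_right _ _) fun _ _ => F0 _ _)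
  have hQw : ∀ a b, w b ≤ Q a b := fun a b =>
    le_add_of_nonneg_right (intervalIntegral.integral_nonneg (le_max_right _ _) fun _ _ => F0 _ _)
  have hPpos : ∀ a b, 0 < P a b := fun a b => (hwpos a).trans_le (hPw a b)
  have hQpos : ∀ a b, 0 < Q a b := fun a b => (hwpos b).trans_le (hQw a b)
  set H : ℝ → ℝ → ℝ := fun a b => -(c a b * (f a b * P a b - g a b * Q a b)) with hH
  have cH : Continuous (uncurry H) := (cc.mul ((cf.mul cP).sub (cg.mul cQ))).neg
  obtain ⟨φ, φa, φb, φ0⟩ := exists_potential cF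
  obtain ⟨χ, χa, χb, χ0⟩ := exists_potential cH
  set T : ℝ → ℝ → ℝ := fun a b => (∫ y in b..a, w y) + φ a b with hT
  set X : ℝ → ℝ → ℝ := fun a b => (a + b) / 2 + χ a b with hX
  set R : ℝ → ℝ → ℝ := fun a b => 1 / 2 + ∫ y in b..max a b, H a y with hR
  set S : ℝ → ℝ → ℝ := fun a b => 1 / 2 - ∫ x in b..max a b, H x b with hS
  have cR : Continuous (uncurry R) := continuous_const.add (continuous_integral_fst cH)
  have cS : Continuous (uncurry S) := continuous_const.sub (continuous_integral_snd cH)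
  have Ta : ∀ a b, HasDerivAt (fun a => T a b) (P a b) a := fun a b =>
    (cw.integral_hasStrictDerivAt b a).hasDerivAt.add (φa a b)
  have Tb : ∀ a b, HasDerivAt (fun b => T a b) (-Q a b) b := fun a b => by
    have h := (intervalIntegral.integral_hasDerivAt_left (cw.intervalIntegrable b a)
      cw.stronglyMeasurable.stronglyMeasurableAtFilter cw.continuousAt).add (φb a b)
    convert! h using 1
    simp only [hQ]; ring
  have Xa : ∀ a b, HasDerivAt (fun a => X a b) (R a b) a := fun a b =>
    (((hasDerivAt_id a).add_const b).div_const 2).add (χa a b)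
  have Xb : ∀ a b, HasDerivAt (fun b => X a b) (S a b) b := fun a b =>
    (((hasDerivAt_id b).const_add a).div_const 2).add (χb a b)
  have hRle : ∀ a b, a ≤ b → R a b = 1 / 2 := fun a b h => by
    simp [hR, max_eq_right h]
  have hSle : ∀ a b, a ≤ b → S a b = 1 / 2 := fun a b h => by
    simp [hS, max_eq_right h]
  have hRge : ∀ a b, b ≤ a → R a b = c a b * P a b := by
    intro a b h
    have cFa : Continuous (F a) := cF.comp (Continuous.prodMk_right a)
    have cHa : Continuous (H a) := cH.comp (Continuous.prodMk_right a)
    have hder : ∀ y ∈ uIcc b a, HasDerivAt (fun y => c a y * (w a + ∫ z in y..a, F a z))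
        (-H a y) y := by
      intro y hy
      rw [uIcc_of_le h] at hy
      have := (hcb a y).mul ((intervalIntegral.integral_hasDerivAt_left
        (cFa.intervalIntegrable y a) cFa.stronglyMeasurable.stronglyMeasurableAtFilter
        cFa.continuousAt).const_add (w a))
      convert! this using 1
      rw [hFPQ]
      have e : w a + ∫ z in y..a, F a z = P a y := by simp only [hP, max_eq_left hy.2]
      rw [e]
      simp only [hH, hf, hg]; ring
    have := intervalIntegral.integral_eq_sub_of_hasDerivAt hder (cHa.neg.intervalIntegrable _ _)
    rw [intervalIntegral.integral_neg, intervalIntegral.integral_same, add_zero, hcw] at this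
    simp only [hR, hP, max_eq_left h]
    linarith
  have hSge : ∀ a b, b ≤ a → S a b = c a b * Q a b := by
    intro a b h
    have cFb : Continuous fun x => F x b := cF.comp (Continuous.prodMk_left b)
    have cHb : Continuous fun x => H x b := cH.comp (Continuous.prodMk_left b)
    have hder : ∀ x ∈ uIcc b a, HasDerivAt (fun x => c x b * (w b + ∫ z in b..x, F z b))
        (-H x b) x := by
      intro x hx
      rw [uIcc_of_le h] at hx
      have := (hca x b).mul ((cFb.integral_hasStrictDerivAt b x).hasDerivAt.const_add (w b))
      convert! this using 1
      rw [hFPQ]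
      have e : w b + ∫ z in b..x, F z b = Q x b := by simp only [hQ, max_eq_left hx.1]
      rw [e]
      simp only [hH, hf, hg]; ring
    have := intervalIntegral.integral_eq_sub_of_hasDerivAt hder (cHb.neg.intervalIntegrable _ _)
    rw [intervalIntegral.integral_neg, intervalIntegral.integral_same, add_zero, hcw] at this
    simp only [hS, hQ, max_eq_left h]
    linarith
  set m : ℝ := min (1 / (2 * k₁)) (min (k₀ * (1 / (2 * k₁))) (1 / 2)) with hm
  have hm0 : 0 < m := by positivity
  have m1 : m ≤ 1 / (2 * k₁) := min_le_left _ _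
  have m2 : m ≤ k₀ * (1 / (2 * k₁)) := (min_le_right _ _).trans (min_le_left _ _)
  have m3 : m ≤ 1 / 2 := (min_le_right _ _).trans (min_le_right _ _)
  have mP : ∀ a b, m ≤ P a b := fun a b => m1.trans ((hw0 a).trans (hPw a b))
  have mQ : ∀ a b, m ≤ Q a b := fun a b => m1.trans ((hw0 b).trans (hQw a b))
  have hk : 0 ≤ 1 / (2 * k₁) := by positivity
  have mR : ∀ a b, m ≤ R a b := fun a b => by
    rcases le_total a b with h | h
    · rwa [hRle a b h]
    · rw [hRge a b h]
      exact m2.trans (mul_le_mul (hc₀ a b) ((hw0 a).trans (hPw a b)) hk (hcpos a b).le)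
  have mS : ∀ a b, m ≤ S a b := fun a b => by
    rcases le_total a b with h | h
    · rwa [hSle a b h]
    · rw [hSge a b h]
      exact m2.trans (mul_le_mul (hc₀ a b) ((hw0 b).trans (hQw a b)) hk (hcpos a b).le)
  obtain ⟨A, B, cA, cB, hinv, hAB⟩ :=
    exists_contDiff_inverse hm0 Ta Tb Xa Xb cP cQ cR cS mP mQ mR mS
  have Tdiag : ∀ a, T a a = 0 := fun a => by simp [hT, φ0 a a le_rfl]
  have Xdiag : ∀ a, X a a = a := fun a => by simp [hX, χ0 a a le_rfl]
  have hPt : ∀ a b, b ≤ a → m + κ₀ * ρ a * T a b ≤ P a b := by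
    intro a b h
    have cQa : Continuous (Q a) := cQ.comp (Continuous.prodMk_right a)
    have cFa : Continuous (F a) := cF.comp (Continuous.prodMk_right a)
    have e := intervalIntegral.integral_eq_sub_of_hasDerivAt (fun y _ => Tb a y)
      (cQa.neg.intervalIntegrable b a)
    rw [intervalIntegral.integral_neg, Tdiag, zero_sub, neg_inj] at e
    rw [← e, ← intervalIntegral.integral_const_mul]
    simp only [hP, max_eq_left h]
    refine add_le_add (m1.trans (hw0 a)) (intervalIntegral.integral_mono_on h
      ((cQa.const_mul _).intervalIntegrable _ _) (cFa.intervalIntegrable _ _) fun y _ => ?_)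
    rw [hFPQ]
    have := mul_nonneg (f0 a y) (hPpos a y).le
    have : κ₀ * ρ a * Q a y ≤ g a y * Q a y :=
      mul_le_mul_of_nonneg_right (mul_le_mul_of_nonneg_right (h₀ a y) (ρ₀ a)) (hQpos a y).le
    linarith
  have hQt : ∀ a b, b ≤ a → m + κ₀ * σ b * T a b ≤ Q a b := by
    intro a b h
    have cPb : Continuous fun x => P x b := cP.comp (Continuous.prodMk_left b)
    have cFb : Continuous fun x => F x b := cF.comp (Continuous.prodMk_left b)
    have e := intervalIntegral.integral_eq_sub_of_hasDerivAt (fun x _ => Ta x b)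
      (cPb.intervalIntegrable b a)
    rw [Tdiag, sub_zero] at e
    rw [← e, ← intervalIntegral.integral_const_mul]
    simp only [hQ, max_eq_left h]
    refine add_le_add (m1.trans (hw0 b)) (intervalIntegral.integral_mono_on h
      ((cPb.const_mul _).intervalIntegrable _ _) (cFb.intervalIntegrable _ _) fun x _ => ?_)
    rw [hFPQ]
    have := mul_nonneg (g0 x b) (hQpos x b).le
    have : κ₀ * σ b * P x b ≤ f x b * P x b :=
      mul_le_mul_of_nonneg_right (mul_le_mul_of_nonneg_right (h₀ x b) (σ₀ b)) (hPpos x b).le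
    linarith
  set C : ℝ := M / (2 * k₀ * m) + 1 / (2 * k₀ * κ₀) with hC
  have hC0 : 0 < C := by positivity
  have hdecay : ∀ t s y z : ℝ, 0 ≤ t → 0 ≤ s → s ≤ M → m + κ₀ * s * t ≤ y → k₀ ≤ z →
      s * (1 / (2 * z * y)) ≤ C * (1 + t)⁻¹ := by
    intro t s y z ht hs hsM hy hz
    have hy0 : 0 < m + κ₀ * s * t := by positivity
    have hz0 := hk₀.trans_le hz
    have hyp := hy0.trans_le hy
    rw [← div_eq_mul_inv, mul_one_div, div_le_div_iff₀ (by positivity) (by positivity)]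
    have e1 : C * (2 * k₀ * (m + κ₀ * s * t)) ≤ C * (2 * z * y) := by gcongr
    have e2 : C * (2 * k₀ * (m + κ₀ * s * t))
        = M + s * t + (M / m * (κ₀ * s * t) + m / κ₀) := by
      simp only [hC]; field_simp; ring
    have e3 : 0 ≤ M / m * (κ₀ * s * t) + m / κ₀ := by positivity
    linarith
  refine ⟨A, B, cA, cB, fun x => ?_, C, hC0, fun t ht x => ?_⟩
  · have := hinv x x
    rwa [Tdiag, Xdiag] at this
  · obtain ⟨a, b, hA, hB, hTt, hXx, At, Ax, Bt, Bx⟩ := hAB t x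
    have hba : b ≤ a := by
      by_contra! hlt
      have := mul_sub_le_of_hasDerivAt (fun z => Ta z b) (fun z => mP z b) hlt.le
      rw [Tdiag, hTt] at this
      have := mul_pos hm0 (sub_pos.2 hlt)
      linarith
    have cp := hcpos a b
    have pp := hPpos a b
    have qp := hQpos a b
    rw [hRge a b hba, hSge a b hba] at At Ax Bt Bx
    rw [hA, hB]
    refine ⟨1 / (2 * c a b * P a b), 1 / (2 * c a b * Q a b), ?_, ?_, ?_, ?_, by positivity,
      by positivity, ?_, ?_⟩
    · convert! At using 1; field_simp; ring
    · convert! Ax using 1; field_simp; ring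
    · convert! Bt using 1; field_simp; ring
    · convert! Bx using 1; field_simp; ring
    · exact hdecay t _ _ _ ht (ρ₀ a) (ρ₁ a) (hTt ▸ hPt a b hba) (hc₀ a b)
    · exact hdecay t _ _ _ ht (σ₀ b) (σ₁ b) (hTt ▸ hQt a b hba) (hc₀ a b)

/-- Global rarefactive solution of the undamped Euler system with prescribed nondecreasing, small
Riemann invariants at time zero. -/
theorem exists_euler_solution_of_riemann_data {γ M : ℝ} {r₀ s₀ ρ σ : ℝ → ℝ} (hγ : 1 < γ)
    (hr : ∀ x, HasDerivAt r₀ (ρ x) x) (hs : ∀ x, HasDerivAt s₀ (σ x) x)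
    (cρ : Continuous ρ) (cσ : Continuous σ)
    (ρ₀ : ∀ a, 0 ≤ ρ a) (ρ₁ : ∀ a, ρ a ≤ M) (σ₀ : ∀ b, 0 ≤ σ b) (σ₁ : ∀ b, σ b ≤ M)
    (br : ∀ x, |r₀ x| ≤ 1 / (γ - 1)) (bs : ∀ x, |s₀ x| ≤ 1 / (γ - 1)) :
    ∃ u v : ℝ → ℝ → ℝ,
      IsC1bOn u stripInf ∧ IsC1bOn v stripInf ∧ IsEulerOn γ 0 0 u v stripInf ∧
      (∀ x, u 0 x = (1 + (γ - 1) / 4 * (s₀ x - r₀ x)) ^ (-2 / (γ - 1)) ∧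
        v 0 x = (r₀ x + s₀ x) / 2) ∧
      (∀ p ∈ stripInf, 0 < u p.1 p.2) ∧
      ∃ C > 0, ∀ t ≥ (0:ℝ), ∀ x : ℝ,
        |pdt (fun t x => rInv γ (u t x) (v t x)) t x| +
        |pdt (fun t x => sInv γ (u t x) (v t x)) t x| +
        |pdx (fun t x => rInv γ (u t x) (v t x)) t x| +
        |pdx (fun t x => sInv γ (u t x) (v t x)) t x|
          ≤ C * (1 + t)⁻¹ := by
  have hg : 0 < γ - 1 := sub_pos.2 hγ
  have hg' := hg.ne'
  set e : ℝ := (γ + 1) / (γ - 1) with he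
  have he0 : 0 < e := by positivity
  set Y : ℝ → ℝ → ℝ := fun a b => 1 + (γ - 1) / 4 * (s₀ b - r₀ a) with hY
  have hYbd : ∀ a b, 1 / 2 ≤ Y a b ∧ Y a b ≤ 3 / 2 := by
    intro a b
    have h1 := abs_le.1 (br a)
    have h2 := abs_le.1 (bs b)
    have h3 : (γ - 1) / 4 * (2 / (γ - 1)) = 1 / 2 := by field_simp; norm_num
    have h4 : (γ - 1) / 4 * (s₀ b - r₀ a) ≤ (γ - 1) / 4 * (2 / (γ - 1)) :=
      mul_le_mul_of_nonneg_left (by rw [← one_add_one_eq_two, add_div]; linarith) (by positivity)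
    have h5 : (γ - 1) / 4 * (-(2 / (γ - 1))) ≤ (γ - 1) / 4 * (s₀ b - r₀ a) :=
      mul_le_mul_of_nonneg_left (by rw [← one_add_one_eq_two, add_div]; linarith) (by positivity)
    simp only [hY]
    constructor <;> linarith
  have hYpos : ∀ a b, 0 < Y a b := fun a b => by linarith [(hYbd a b).1]
  have cr : Continuous r₀ := continuous_iff_continuousAt.2 fun x => (hr x).continuousAt
  have cs : Continuous s₀ := continuous_iff_continuousAt.2 fun x => (hs x).continuousAt
  have cY : Continuous (uncurry Y) := by
    simp only [hY, uncurry_def]; fun_prop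
  set k₀ : ℝ := (1 / 2 : ℝ) ^ e with hk₀
  set k₁ : ℝ := (3 / 2 : ℝ) ^ e with hk₁
  have k₀pos : 0 < k₀ := by positivity
  have k₁pos : 0 < k₁ := by positivity
  have hlo : ∀ a b, k₀ ≤ Y a b ^ e := fun a b =>
    rpow_le_rpow (by norm_num) (hYbd a b).1 he0.le
  have hhi : ∀ a b, Y a b ^ e ≤ k₁ := fun a b =>
    rpow_le_rpow (hYpos a b).le (hYbd a b).2 he0.le
  have hYe : ∀ a b, Y a b ^ (e - 1) = Y a b ^ e / Y a b := fun a b => by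
    rw [rpow_sub (hYpos a b), rpow_one]
  obtain ⟨A, B, cA, cB, hinit, C, hC, hmain⟩ := exists_characteristic_coordinates
    (c := fun a b => Y a b ^ e) (κ := fun a b => (γ + 1) / 8 / Y a b) (ρ := ρ) (σ := σ)
    (k₀ := k₀) (k₁ := k₁) (κ₀ := (γ + 1) / 8 / (3 / 2)) (κ₁ := (γ + 1) / 8 / (1 / 2)) (M := M)
    k₀pos (by positivity) hlo hhi
    (fun a b => by have := hYpos a b; have := (hYbd a b).2; gcongr)
    (fun a b => by have := hYpos a b; have := (hYbd a b).1; gcongr)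
    ρ₀ ρ₁ σ₀ σ₁
    (cY.rpow_const fun p => Or.inl (hYpos p.1 p.2).ne')
    (continuous_const.div cY fun p => (hYpos p.1 p.2).ne') cρ cσ
    (fun a b => by
      have hd : HasDerivAt (fun a => Y a b) ((γ - 1) / 4 * (-ρ a)) a :=
        (((hr a).const_sub (s₀ b)).const_mul _).const_add 1
      have := hYpos a b
      convert! hd.rpow_const (p := e) (Or.inl (hYpos a b).ne') using 1
      rw [hYe, he]; field_simp; ring)
    (fun a b => by
      have hd : HasDerivAt (fun b => Y a b) ((γ - 1) / 4 * σ b) b :=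
        (((hs b).sub_const (r₀ a)).const_mul _).const_add 1
      have := hYpos a b
      convert! hd.rpow_const (p := e) (Or.inl (hYpos a b).ne') using 1
      rw [hYe, he]; field_simp; ring)
  have dr : ContDiff ℝ 1 r₀ := contDiff_one_iff_deriv.2
    ⟨fun x => (hr x).differentiableAt, by rwa [funext fun x => (hr x).deriv]⟩
  have ds : ContDiff ℝ 1 s₀ := contDiff_one_iff_deriv.2
    ⟨fun x => (hs x).differentiableAt, by rwa [funext fun x => (hs x).deriv]⟩
  have dR : ContDiff ℝ 1 (uncurry fun t x => r₀ (A t x)) := dr.comp cA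
  have dS : ContDiff ℝ 1 (uncurry fun t x => s₀ (B t x)) := ds.comp cB
  have dY : ContDiff ℝ 1 (uncurry fun t x => Y (A t x) (B t x)) :=
    contDiff_const.add (contDiff_const.mul (dS.sub dR))
  set u : ℝ → ℝ → ℝ := fun t x => Y (A t x) (B t x) ^ (-2 / (γ - 1)) with hu
  set v : ℝ → ℝ → ℝ := fun t x => (r₀ (A t x) + s₀ (B t x)) / 2 with hv
  have du : ContDiff ℝ 1 (uncurry u) := dY.rpow_const_of_ne fun p => (hYpos _ _).ne'
  have dv : ContDiff ℝ 1 (uncurry v) := (dR.add dS).div_const 2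
  have hpow : ∀ t x, u t x ^ (-(γ - 1) / 2) = Y (A t x) (B t x) := by
    intro t x
    simp only [hu]
    rw [← rpow_mul (hYpos _ _).le]
    have : -2 / (γ - 1) * (-(γ - 1) / 2) = 1 := by field_simp
    rw [this, rpow_one]
  have hrInv : (fun t x => rInv γ (u t x) (v t x)) = fun t x => r₀ (A t x) := by
    funext t x
    simp only [rInv, hpow, hv, hY]; field_simp; ring
  have hsInv : (fun t x => sInv γ (u t x) (v t x)) = fun t x => s₀ (B t x) := by
    funext t x
    simp only [sInv, hpow, hv, hY]; field_simp; ring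
  have hpres : (fun t x => pres γ (u t x))
      = fun t x => Y (A t x) (B t x) ^ (2 * γ / (γ - 1)) / γ := by
    funext t x
    simp only [pres, hu]
    rw [← rpow_mul (hYpos _ _).le]
    congr 2; field_simp
  have hderivs : ∀ t, 0 ≤ t → ∀ x, ∃ k a b : ℝ, k₀ ≤ k ∧ k ≤ k₁ ∧ 0 ≤ a ∧ 0 ≤ b ∧
      a ≤ C * (1 + t)⁻¹ ∧ b ≤ C * (1 + t)⁻¹ ∧
      HasDerivAt (fun t => r₀ (A t x)) (k * a) t ∧ HasDerivAt (fun x => r₀ (A t x)) a x ∧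
      HasDerivAt (fun t => s₀ (B t x)) (-(k * b)) t ∧ HasDerivAt (fun x => s₀ (B t x)) b x ∧
      HasDerivAt (fun t => u t x) ((a + b) / 2) t ∧
      HasDerivAt (fun x => u t x) (-((b - a) / 2 / k)) x ∧
      HasDerivAt (fun t => v t x) (k * (a - b) / 2) t ∧
      HasDerivAt (fun x => v t x) ((a + b) / 2) x ∧
      HasDerivAt (fun x => pres γ (u t x)) (k * (b - a) / 2) x := by
    intro t ht x
    obtain ⟨p, q, At, Ax, Bt, Bx, hp, hq, hrp, hsq⟩ := hmain t ht x
    set y := Y (A t x) (B t x) with hy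
    have y0 : 0 < y := hYpos _ _
    have rt : HasDerivAt (fun t => r₀ (A t x)) (y ^ e * (ρ (A t x) * p)) t := by
      convert! (hr (A t x)).comp t At using 1; ring
    have rx : HasDerivAt (fun x => r₀ (A t x)) (ρ (A t x) * p) x := (hr (A t x)).comp x Ax
    have st : HasDerivAt (fun t => s₀ (B t x)) (-(y ^ e * (σ (B t x) * q))) t := by
      convert! (hs (B t x)).comp t Bt using 1; ring
    have sx : HasDerivAt (fun x => s₀ (B t x)) (σ (B t x) * q) x := (hs (B t x)).comp x Bx
    have k0 : 0 < y ^ e := rpow_pos_of_pos y0 e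
    have Yt : HasDerivAt (fun t => Y (A t x) (B t x)) _ t :=
      ((st.sub rt).const_mul ((γ - 1) / 4)).const_add 1
    have Yx : HasDerivAt (fun x => Y (A t x) (B t x)) _ x :=
      ((sx.sub rx).const_mul ((γ - 1) / 4)).const_add 1
    have e1 : y ^ (-2 / (γ - 1) - 1) = (y ^ e)⁻¹ := by
      rw [← rpow_neg y0.le]; congr 1; rw [he]; field_simp; ring
    have e2 : y ^ (2 * γ / (γ - 1) - 1) = y ^ e := by
      congr 1; rw [he]; field_simp; ring
    refine ⟨y ^ e, ρ (A t x) * p, σ (B t x) * q, hlo _ _, hhi _ _, mul_nonneg (ρ₀ _) hp,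
      mul_nonneg (σ₀ _) hq, hrp, hsq, rt, rx, st, sx, ?_, ?_, ?_, ?_, ?_⟩
    · convert! Yt.rpow_const (p := -2 / (γ - 1)) (Or.inl y0.ne') using 1
      rw [← hy, e1]; field_simp; ring
    · convert! Yx.rpow_const (p := -2 / (γ - 1)) (Or.inl y0.ne') using 1
      rw [← hy, e1]; field_simp; ring
    · convert! (rt.add st).div_const 2 using 1
      ring
    · exact (rx.add sx).div_const 2
    · have h := (Yx.rpow_const (p := 2 * γ / (γ - 1)) (Or.inl y0.ne')).div_const γ
      rw [← hy, e2] at h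
      have : (fun x => pres γ (u t x)) = fun x => Y (A t x) (B t x) ^ (2 * γ / (γ - 1)) / γ :=
        congrFun hpres t
      rw [this]
      convert! h using 1
      field_simp; ring
  have hinv1 : ∀ t : ℝ, 0 ≤ t → C * (1 + t)⁻¹ ≤ C := fun t ht =>
    mul_le_of_le_one_right hC.le (inv_le_one_of_one_le₀ (by linarith))
  refine ⟨u, v, ⟨du.contDiffOn, (1 / 2 : ℝ) ^ (-2 / (γ - 1)) + C + C / k₀, ?_⟩,
    ⟨dv.contDiffOn, 1 / (γ - 1) + k₁ * C + C, ?_⟩, ?_, fun x => ?_,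
    fun p _ => rpow_pos_of_pos (hYpos _ _) _, 2 * (k₁ + 1) * C, by positivity, ?_⟩
  · rintro ⟨t, x⟩ ⟨ht : 0 ≤ t, -⟩
    obtain ⟨k, a, b, hk0, hk1, ha, hb, ha1, hb1, -, -, -, -, ut, ux, -, -, -⟩ := hderivs t ht x
    have hkp := k₀pos.trans_le hk0
    have hC1 := hinv1 t ht
    simp only [pdt, pdx]
    rw [ut.deriv, ux.deriv]
    refine add_le_add (add_le_add ?_ ?_) ?_
    · rw [abs_of_pos (rpow_pos_of_pos (hYpos _ _) _)]
      exact rpow_le_rpow_of_nonpos (by norm_num) (hYbd _ _).1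
        (div_nonpos_of_nonpos_of_nonneg (by norm_num) hg.le)
    · rw [abs_of_nonneg (by positivity)]; linarith
    · rw [abs_neg, abs_div, abs_of_pos hkp]
      refine div_le_div₀ hC.le ?_ k₀pos hk0
      rw [abs_le]; constructor <;> linarith
  · rintro ⟨t, x⟩ ⟨ht : 0 ≤ t, -⟩
    obtain ⟨k, a, b, hk0, hk1, ha, hb, ha1, hb1, -, -, -, -, -, -, vt, vx, -⟩ := hderivs t ht x
    have hkp := k₀pos.trans_le hk0
    have hC1 := hinv1 t ht
    simp only [pdt, pdx]
    rw [vt.deriv, vx.deriv]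
    refine add_le_add (add_le_add ?_ ?_) ?_
    · have h1 := abs_le.1 (br (A t x))
      have h2 := abs_le.1 (bs (B t x))
      simp only [hv]
      rw [abs_le]; constructor <;> linarith
    · rw [mul_div_assoc, abs_mul, abs_of_pos hkp]
      refine mul_le_mul hk1 ?_ (abs_nonneg _) k₁pos.le
      rw [abs_le]; constructor <;> linarith
    · rw [abs_of_nonneg (by positivity)]; linarith
  · rintro ⟨t, x⟩ ⟨ht : 0 ≤ t, -⟩
    obtain ⟨k, a, b, -, -, -, -, -, -, -, -, -, -, ut, -, vt, vx, px⟩ := hderivs t ht x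
    simp only [pdt, pdx]
    rw [ut.deriv, vt.deriv, vx.deriv, px.deriv]
    constructor
    · ring
    · simp only [zero_div, neg_zero, zero_mul]; ring
  · simp only [hu, hv, hY, (hinit x).1, (hinit x).2, and_self]
  · intro t ht x
    obtain ⟨k, a, b, hk0, hk1, ha, hb, ha1, hb1, rt, rx, st, sx, -⟩ := hderivs t ht x
    have hkp := k₀pos.trans_le hk0
    rw [hrInv, hsInv]
    simp only [pdt, pdx]
    rw [rt.deriv, rx.deriv, st.deriv, sx.deriv, abs_neg, abs_of_nonneg (mul_nonneg hkp.le ha),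
      abs_of_nonneg (mul_nonneg hkp.le hb), abs_of_nonneg ha, abs_of_nonneg hb]
    have e1 := mul_le_mul hk1 ha1 ha k₁pos.le
    have e2 := mul_le_mul hk1 hb1 hb k₁pos.le
    linarith

/-- For the undamped Euler system (`λ = 0`), if the initial
Riemann invariants associated with `(1 + εφ, εψ)` are nondecreasing in `x`,
then for small `ε` there is a global `C¹_b` solution with decay
`‖(r_t,s_t)(t)‖_∞ + ‖(r_x,s_x)(t)‖_∞ ≤ C(1+t)⁻¹`. -/
theorem undamped_global_existence_decay
    (γ : ℝ) (φ ψ : ℝ → ℝ) (hγ : 1 < γ)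
    (hφ : IsC1b φ) (hψ : IsC1b ψ) :
    ∃ ε₀ > 0, ∀ ε : ℝ, 0 < ε → ε ≤ ε₀ →
      (∀ x : ℝ, 0 ≤ deriv (fun ξ => rInv γ (1 + ε * φ ξ) (ε * ψ ξ)) x) →
      (∀ x : ℝ, 0 ≤ deriv (fun ξ => sInv γ (1 + ε * φ ξ) (ε * ψ ξ)) x) →
      ∃ u v : ℝ → ℝ → ℝ,
        IsC1bOn u stripInf ∧ IsC1bOn v stripInf ∧
        IsEulerOn γ 0 0 u v stripInf ∧
        (∀ x, u 0 x = 1 + ε * φ x ∧ v 0 x = ε * ψ x) ∧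
        (∀ p ∈ stripInf, 0 < u p.1 p.2) ∧
        ∃ C > 0, ∀ t ≥ (0:ℝ), ∀ x : ℝ,
          |pdt (fun t x => rInv γ (u t x) (v t x)) t x| +
          |pdt (fun t x => sInv γ (u t x) (v t x)) t x| +
          |pdx (fun t x => rInv γ (u t x) (v t x)) t x| +
          |pdx (fun t x => sInv γ (u t x) (v t x)) t x|
            ≤ C * (1 + t)⁻¹ := by
  have hγ' : 0 < γ - 1 := by linarith
  obtain ⟨dφ, M₁, hM₁⟩ := hφ
  obtain ⟨dψ, M₂, hM₂⟩ := hψ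
  have bφ : ∀ x, |φ x| ≤ M₁ := fun x => by linarith [hM₁ x, abs_nonneg (deriv φ x)]
  have bφ' : ∀ x, |deriv φ x| ≤ M₁ := fun x => by linarith [hM₁ x, abs_nonneg (φ x)]
  have bψ : ∀ x, |ψ x| ≤ M₂ := fun x => by linarith [hM₂ x, abs_nonneg (deriv ψ x)]
  have bψ' : ∀ x, |deriv ψ x| ≤ M₂ := fun x => by linarith [hM₂ x, abs_nonneg (ψ x)]
  have M₁0 : 0 ≤ M₁ := (abs_nonneg _).trans (bφ 0)
  have M₂0 : 0 ≤ M₂ := (abs_nonneg _).trans (bψ 0)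
  obtain ⟨cφ, cφ'⟩ := contDiff_one_iff_deriv.1 dφ
  obtain ⟨cψ, cψ'⟩ := contDiff_one_iff_deriv.1 dψ
  obtain ⟨δ, δ0, hδ, hδ'⟩ : ∃ δ > 0, δ ≤ 1 / 2 ∧
      ∀ z : ℝ, |z| ≤ δ → |(1 + z) ^ (-(γ - 1) / 2) - 1| ≤ 1 / 4 := by
    have hc : ContinuousAt (fun z : ℝ => (1 + z) ^ (-(γ - 1) / 2)) 0 :=
      ContinuousAt.rpow_const (by fun_prop) (Or.inl (by norm_num))
    obtain ⟨δ, δ0, h⟩ := Metric.continuousAt_iff.1 hc (1 / 4) (by norm_num)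
    refine ⟨min (δ / 2) (1 / 2), by positivity, min_le_right _ _, fun z hz => ?_⟩
    have h1 := @h z (by
      rw [Real.dist_eq, sub_zero]; linarith [min_le_left (δ / 2) (1 / 2)])
    rw [Real.dist_eq, add_zero, one_rpow] at h1
    exact h1.le
  refine ⟨min (δ / (M₁ + 1)) (1 / (2 * (γ - 1)) / (M₂ + 1)), by positivity,
    fun ε ε0 hε hr hs => ?_⟩
  have zφ : ∀ x, |ε * φ x| ≤ δ := fun x => by
    have h1 := hε.trans (min_le_left _ _)
    rw [le_div_iff₀ (by positivity)] at h1
    rw [abs_mul, abs_of_pos ε0]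
    nlinarith [bφ x]
  have zψ : ∀ x, |ε * ψ x| ≤ 1 / (2 * (γ - 1)) := fun x => by
    have h1 := hε.trans (min_le_right _ _)
    rw [le_div_iff₀ (by positivity)] at h1
    rw [abs_mul, abs_of_pos ε0]
    nlinarith [bψ x]
  have u_ge : ∀ x, 1 / 2 ≤ 1 + ε * φ x := fun x => by linarith [neg_abs_le (ε * φ x), zφ x]
  have u_pos : ∀ x, 0 < 1 + ε * φ x := fun x => by linarith [u_ge x]
  have hpow : ∀ x, HasDerivAt (fun ξ => 2 / (γ - 1) * (1 + ε * φ ξ) ^ (-(γ - 1) / 2))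
      (-(ε * deriv φ x * (1 + ε * φ x) ^ (-(γ - 1) / 2 - 1))) x := fun x => by
    refine ((((cφ x).hasDerivAt.const_mul ε).const_add 1).rpow_const
      (p := -(γ - 1) / 2) (Or.inl (u_pos x).ne')).const_mul (2 / (γ - 1)) |>.congr_deriv ?_
    field_simp
  have hψ₁ : ∀ x, HasDerivAt (fun ξ => ε * ψ ξ) (ε * deriv ψ x) x := fun x =>
    (cψ x).hasDerivAt.const_mul ε
  have hr₁ : ∀ x, HasDerivAt (fun ξ => rInv γ (1 + ε * φ ξ) (ε * ψ ξ))
      (ε * deriv ψ x + ε * deriv φ x * (1 + ε * φ x) ^ (-(γ - 1) / 2 - 1)) x := fun x => by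
    simpa [rInv] using ((hψ₁ x).sub (hpow x)).add_const (2 / (γ - 1))
  have hs₁ : ∀ x, HasDerivAt (fun ξ => sInv γ (1 + ε * φ ξ) (ε * ψ ξ))
      (ε * deriv ψ x - ε * deriv φ x * (1 + ε * φ x) ^ (-(γ - 1) / 2 - 1)) x := fun x => by
    simpa [sInv, sub_eq_add_neg] using ((hψ₁ x).add (hpow x)).sub_const (2 / (γ - 1))
  have cpow : Continuous fun x => (1 + ε * φ x) ^ (-(γ - 1) / 2 - 1) :=
    (continuous_const.add (continuous_const.mul cφ.continuous)).rpow_const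
      fun x => Or.inl (u_pos x).ne'
  have bprod : ∀ x, |ε * deriv φ x * (1 + ε * φ x) ^ (-(γ - 1) / 2 - 1)| ≤
      ε * M₁ * (1 / 2) ^ (-(γ - 1) / 2 - 1) := fun x => by
    have h1 : (1 + ε * φ x) ^ (-(γ - 1) / 2 - 1) ≤ (1 / 2 : ℝ) ^ (-(γ - 1) / 2 - 1) :=
      rpow_le_rpow_of_nonpos (by norm_num) (u_ge x) (by linarith)
    have h2 := rpow_nonneg (u_pos x).le (-(γ - 1) / 2 - 1)
    rw [abs_mul, abs_mul, abs_of_pos ε0, abs_of_nonneg h2]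
    have := bφ' x
    gcongr
  have bsum : ∀ x, |ε * deriv ψ x| ≤ ε * M₂ := fun x => by
    rw [abs_mul, abs_of_pos ε0]
    exact mul_le_mul_of_nonneg_left (bψ' x) ε0.le
  have hw : ∀ x, |2 / (γ - 1) * ((1 + ε * φ x) ^ (-(γ - 1) / 2) - 1)| ≤ 1 / (2 * (γ - 1)) :=
    fun x => by
      rw [abs_mul, abs_of_pos (by positivity : 0 < 2 / (γ - 1))]
      calc _ ≤ 2 / (γ - 1) * (1 / 4) := by gcongr; exact hδ' _ (zφ x)
        _ = _ := by field_simp; norm_num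
  have hhalf : 1 / (γ - 1) = 1 / (2 * (γ - 1)) + 1 / (2 * (γ - 1)) := by field_simp; norm_num
  obtain ⟨u, v, hu, hv, hE, hi, hp, hC⟩ := exists_euler_solution_of_riemann_data
    (M := ε * M₂ + ε * M₁ * (1 / 2) ^ (-(γ - 1) / 2 - 1)) hγ hr₁ hs₁
    (by fun_prop) (by fun_prop)
    (fun x => (hr₁ x).deriv ▸ hr x)
    (fun x => by linarith [le_abs_self (ε * deriv ψ x), bsum x, (le_abs_self _).trans (bprod x)])
    (fun x => (hs₁ x).deriv ▸ hs x)
    (fun x => by linarith [le_abs_self (ε * deriv ψ x), bsum x, (neg_le_abs _).trans (bprod x)])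
    (fun x => by
      rw [hhalf, show rInv γ (1 + ε * φ x) (ε * ψ x) = ε * ψ x -
        2 / (γ - 1) * ((1 + ε * φ x) ^ (-(γ - 1) / 2) - 1) by rw [rInv]; ring]
      exact (abs_sub _ _).trans (add_le_add (zψ x) (hw x)))
    (fun x => by
      rw [hhalf, show sInv γ (1 + ε * φ x) (ε * ψ x) = ε * ψ x +
        2 / (γ - 1) * ((1 + ε * φ x) ^ (-(γ - 1) / 2) - 1) by rw [sInv]; ring]
      exact (abs_add_le _ _).trans (add_le_add (zψ x) (hw x)))
  refine ⟨u, v, hu, hv, hE, fun x => ?_, hp, hC⟩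
  obtain ⟨h1, h2⟩ := hi x
  rw [h1, h2]
  constructor
  · rw [show 1 + (γ - 1) / 4 * (sInv γ (1 + ε * φ x) (ε * ψ x) -
      rInv γ (1 + ε * φ x) (ε * ψ x)) = (1 + ε * φ x) ^ (-(γ - 1) / 2) by
        rw [rInv, sInv]; field_simp; ring, ← rpow_mul (u_pos x).le,
      show -(γ - 1) / 2 * (-2 / (γ - 1)) = 1 by field_simp, rpow_one]
  · rw [rInv, sInv]; ring
end
end
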